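/- arXiv:1103.0327 — 2 statements merged into one kernel-verified Lean document; each statement's English description precedes it below -/
import Mathlib

section
/- Let n ≥ 2, J > 0 and H ∈ ℝ. Let P be the transition matrix of the Glauber dynamics for the mean-field Ising model on the complete graph with n vertices, coupling J and uniform external field H, and let P̃ be the associated (n+1)×(n+1) magnetization chain matrix. Then the second-largest eigenvalue of P̃ equals the second-largest eigenvalue λ₂ of P, and P̃ has a right eigenvector f = (f_0, f_1, …, f_n) for this eigenvalue which is increasing (f_k ≤ f_{k+1} for all 0 ≤ k ≤ n−1) and strictly increasing at some index (f_k < f_{k+1} for at least one k). -/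
/-- The spin value of a site: `+1` for `true`, `-1` for `false`. -/
def spin (b : Bool) : ℝ := if b then 1 else -1

/-- The rate at which the Glauber dynamics for the mean-field Ising model on the
complete graph with `n` vertices, coupling `J` and uniform external field `H`
flips the spin at vertex `x` of the configuration `σ`:
`(1/n) · 1/(1 + exp(−2 σ'_x (J Σ_{y≠x} σ_y + H)))` where `σ'_x = −σ_x`. -/
noncomputable def flipRate (n : ℕ) (J H : ℝ) (σ : Fin n → Bool) (x : Fin n) : ℝ :=
  (1 / (n : ℝ)) *
    (1 + Real.exp (-2 * spin (!σ x) *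
      (J * ∑ y ∈ Finset.univ.erase x, spin (σ y) + H)))⁻¹

/-- The transition matrix of the Glauber dynamics for the mean-field Ising model on
the complete graph with `n` vertices, coupling `J` and uniform external field `H`.
Transitions change at most one coordinate. -/
noncomputable def glauberP (n : ℕ) (J H : ℝ) : Matrix (Fin n → Bool) (Fin n → Bool) ℝ :=
  fun σ σ' =>
    if σ' = σ then 1 - ∑ x : Fin n, flipRate n J H σ x
    else ∑ x : Fin n, if σ' = Function.update σ x (!σ x) then flipRate n J H σ x else 0

/-- `μ` is a (real) eigenvalue of the matrix `M`. -/
def IsEigenvalue {m : Type*} [Fintype m] (M : Matrix m m ℝ) (μ : ℝ) : Prop :=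
  ∃ v : m → ℝ, v ≠ 0 ∧ M.mulVec v = μ • v

/-- `μ` is the second-largest eigenvalue of the transition matrix `M` whose
eigenvalues are real and satisfy `1 = λ₁ > λ₂ ≥ … ≥ λ_N`: it is the largest
eigenvalue different from `1`. -/
def IsSecondEigenvalue {m : Type*} [Fintype m] (M : Matrix m m ℝ) (μ : ℝ) : Prop :=
  IsEigenvalue M μ ∧ μ ≠ 1 ∧ ∀ μ' : ℝ, IsEigenvalue M μ' → μ' ≠ 1 → μ' ≤ μ


/-- Upward transition rate of the magnetization chain:
`P̃_{k,k+1} = ((n−k)/n) · 1/(1 + exp((n−2k−1)·2J − 2H))`. -/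
noncomputable def pUp (n : ℕ) (J H : ℝ) (k : ℕ) : ℝ :=
  (((n : ℝ) - k) / n) * (1 + Real.exp (((n : ℝ) - 2 * k - 1) * (2 * J) - 2 * H))⁻¹

/-- Downward transition rate of the magnetization chain:
`P̃_{k,k−1} = (k/n) · 1/(1 + exp(−(n−2k+1)·2J + 2H))`. -/
noncomputable def pDown (n : ℕ) (J H : ℝ) (k : ℕ) : ℝ :=
  ((k : ℝ) / n) * (1 + Real.exp (-((n : ℝ) - 2 * k + 1) * (2 * J) + 2 * H))⁻¹

/-- The `(n+1)×(n+1)` tridiagonal transition matrix of the magnetization chain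
associated to the mean-field Glauber dynamics.  (Note `pDown n J H 0 = 0` and
`pUp n J H n = 0`, implementing the conventions `P̃_{0,−1} = P̃_{n,n+1} = 0`.) -/
noncomputable def magP (n : ℕ) (J H : ℝ) : Matrix (Fin (n + 1)) (Fin (n + 1)) ℝ :=
  fun k l =>
    if (l : ℕ) = (k : ℕ) + 1 then pUp n J H k
    else if (k : ℕ) = (l : ℕ) + 1 then pDown n J H k
    else if k = l then 1 - pDown n J H k - pUp n J H k
    else 0

/-! ### Positive eigenvectors of tridiagonal matrices -/

/-- The solution with initial value `1` of the three-term recurrence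
`μ g_k = d_k g_k + c_k g_{k-1} + w_k g_{k+1}` (where `g_{-1} = 0`). -/
noncomputable def tridiagSol (c d w : ℕ → ℝ) (μ : ℝ) : ℕ → ℝ
  | 0 => 1
  | 1 => (μ - d 0) / w 0
  | k + 2 =>
    ((μ - d (k + 1)) * tridiagSol c d w μ (k + 1) - c (k + 1) * tridiagSol c d w μ k) / w (k + 1)

lemma tridiagSol_recurrence {c d w : ℕ → ℝ} (hc : c 0 = 0) (hw : ∀ k, 0 < w k) (μ : ℝ) (k : ℕ) :
    μ * tridiagSol c d w μ k = d k * tridiagSol c d w μ k + c k * tridiagSol c d w μ (k - 1)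
      + w k * tridiagSol c d w μ (k + 1) := by
  have := (hw k).ne'
  rcases k with _ | k
  · simp only [tridiagSol, hc]
    field_simp
    ring
  · simp only [tridiagSol, Nat.add_sub_cancel]
    field_simp
    ring

lemma continuous_tridiagSol (c d w : ℕ → ℝ) (k : ℕ) :
    Continuous fun μ => tridiagSol c d w μ k := by
  induction k using Nat.twoStepInduction with
  | zero => simpa only [tridiagSol] using continuous_const
  | one => simp only [tridiagSol]; fun_prop
  | more k h₀ h₁ => simp only [tridiagSol]; fun_prop

lemma exists_tridiagSol_pos {c d w : ℕ → ℝ} (hc : c 0 = 0) (hc' : ∀ k, 0 ≤ c k)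
    (hw : ∀ k, 0 < w k) (n : ℕ) : ∃ μ, ∀ k ≤ n, 0 < tridiagSol c d w μ k := by
  refine ⟨∑ k ∈ Finset.range n, (|d k| + c k + w k), ?_⟩
  set μ := ∑ k ∈ Finset.range n, (|d k| + c k + w k)
  have hμ : ∀ k < n, |d k| + c k + w k ≤ μ := fun k hk =>
    Finset.single_le_sum (f := fun k => |d k| + c k + w k)
      (fun j _ => by have := hc' j; have := hw j; positivity) (Finset.mem_range.2 hk)
  suffices h : ∀ k ≤ n, 0 < tridiagSol c d w μ k ∧
      tridiagSol c d w μ (k - 1) ≤ tridiagSol c d w μ k from fun k hk => (h k hk).1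
  intro k
  induction k with
  | zero => simp [tridiagSol]
  | succ k ih =>
    intro hk
    obtain ⟨hpos, hle⟩ := ih (by omega)
    have hrec := tridiagSol_recurrence (d := d) hc hw μ k
    have hb := hμ k (by omega)
    have hge : tridiagSol c d w μ k ≤ tridiagSol c d w μ (k + 1) := by
      refine le_of_mul_le_mul_left ?_ (hw k)
      have h₁ := mul_le_mul_of_nonneg_left hle (hc' k)
      have h₂ : (d k + c k + w k) * tridiagSol c d w μ k ≤ μ * tridiagSol c d w μ k :=
        mul_le_mul_of_nonneg_right (by linarith [le_abs_self (d k)]) hpos.le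
      linarith
    exact ⟨hpos.trans_le hge, hge⟩

/-- A tridiagonal matrix with positive off-diagonal entries has a positive eigenvector. -/
lemma exists_tridiagSol_pos_eq_zero {c d w : ℕ → ℝ} (hc : c 0 = 0) (hc' : ∀ k, 1 ≤ k → 0 < c k)
    (hw : ∀ k, 0 < w k) {n : ℕ} (hn : 1 ≤ n) :
    ∃ μ, (∀ k < n, 0 < tridiagSol c d w μ k) ∧ tridiagSol c d w μ n = 0 := by
  have hc'' : ∀ k, 0 ≤ c k := fun k => by
    rcases Nat.eq_zero_or_pos k with rfl | hk
    exacts [hc.ge, (hc' k hk).le]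
  set S : Set ℝ := {μ | ∀ k ∈ Set.Iic n, 0 < tridiagSol c d w μ k} with hS
  have hopen : IsOpen S := by
    have : S = ⋂ k ∈ Set.Iic n, {μ | 0 < tridiagSol c d w μ k} := by ext; simp [hS]
    rw [this]
    exact (Set.finite_Iic n).isOpen_biInter fun k _ =>
      isOpen_lt continuous_const (continuous_tridiagSol c d w k)
  have hne : S.Nonempty := exists_tridiagSol_pos hc hc'' hw n
  have hbdd : BddBelow S := by
    refine ⟨d 0, fun μ hμ => ?_⟩
    have h : 0 < (μ - d 0) / w 0 := by simpa only [tridiagSol] using hμ 1 hn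
    have := (div_pos_iff_of_pos_right (hw 0)).1 h
    linarith
  have hmem : sInf S ∉ S := fun h => by
    obtain ⟨ε, hε, hball⟩ := Metric.isOpen_iff.1 hopen _ h
    have hlt : sInf S - ε / 2 ∈ S := hball (by
      rw [Metric.mem_ball, Real.dist_eq, abs_lt]; constructor <;> linarith)
    linarith [csInf_le hbdd hlt]
  have hnonneg : ∀ k ≤ n, 0 ≤ tridiagSol c d w (sInf S) k := fun k hk =>
    closure_minimal (fun μ hμ => (hμ k hk).le)
      (isClosed_le continuous_const (continuous_tridiagSol c d w k)) (csInf_mem_closure hne hbdd)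
  have hex : ∃ k, k ≤ n ∧ tridiagSol c d w (sInf S) k ≤ 0 := by
    by_contra! h
    exact hmem h
  classical
  obtain ⟨hk, hk0⟩ := Nat.find_spec hex
  have hmin : ∀ j < Nat.find hex, 0 < tridiagSol c d w (sInf S) j := fun j hj => by
    have := Nat.find_min hex hj
    push Not at this
    exact this (by omega)
  have hzero := le_antisymm hk0 (hnonneg _ hk)
  have hfind : Nat.find hex = n := by
    by_contra hkn
    have hpos : 1 ≤ Nat.find hex := by
      by_contra h
      have h0 : Nat.find hex = 0 := by omega
      rw [h0] at hzero
      simp [tridiagSol] at hzero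
    have hrec := tridiagSol_recurrence (d := d) hc hw (sInf S) (Nat.find hex)
    have h₁ := mul_pos (hc' _ hpos) (hmin (Nat.find hex - 1) (by omega))
    have h₂ := mul_nonneg (hw (Nat.find hex)).le (hnonneg (Nat.find hex + 1) (by omega))
    rw [hzero] at hrec
    linarith
  rw [hfind] at hmin hzero
  exact ⟨_, hmin, hzero⟩

/-! ### The magnetization chain -/

section Magnetization

variable (n : ℕ) (J H : ℝ)

lemma pDown_zero : pDown n J H 0 = 0 := by simp [pDown]

lemma pUp_self : pUp n J H n = 0 := by simp [pUp]

variable {n} in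
lemma pUp_pos {k : ℕ} (hk : k < n) : 0 < pUp n J H k := by
  have h : (k : ℝ) < n := by exact_mod_cast hk
  have h' : (0 : ℝ) < n := by exact_mod_cast (by omega : 0 < n)
  have : 0 < (n : ℝ) - k := by linarith
  unfold pUp
  positivity

variable {n} in
lemma pDown_pos (hn : 1 ≤ n) {k : ℕ} (hk : 1 ≤ k) : 0 < pDown n J H k := by
  have h : (0 : ℝ) < k := by exact_mod_cast hk
  have h' : (0 : ℝ) < n := by exact_mod_cast hn
  unfold pDown
  positivity

lemma magP_mulVec_apply (f : ℕ → ℝ) (k : Fin (n + 1)) :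
    (magP n J H).mulVec (fun i => f i) k =
      f k + pUp n J H k * (f (k + 1) - f k) + pDown n J H k * (f (k - 1) - f k) := by
  obtain ⟨k, hk⟩ := k
  have hterm : ∀ l : Fin (n + 1), magP n J H ⟨k, hk⟩ l * f l =
      (fun l : ℕ => (if l = k + 1 then pUp n J H k * f l else 0)
        + (if l = k - 1 then pDown n J H k * f l else 0)
        + (if l = k then (1 - pDown n J H k - pUp n J H k) * f l else 0)) l := by
    rintro ⟨l, hl⟩
    rcases Nat.eq_zero_or_pos k with rfl | hk0
    · simp only [magP, Fin.mk.injEq, pDown_zero]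
      split_ifs <;> first | omega | contradiction | ring
    · simp only [magP, Fin.mk.injEq]
      split_ifs <;> first | omega | ring
  simp only [Matrix.mulVec, dotProduct]
  rw [Finset.sum_congr rfl fun l _ => hterm l, Fin.sum_univ_eq_sum_range
    (fun l : ℕ => (if l = k + 1 then pUp n J H k * f l else 0)
        + (if l = k - 1 then pDown n J H k * f l else 0)
        + (if l = k then (1 - pDown n J H k - pUp n J H k) * f l else 0))]
  simp only [Finset.sum_add_distrib, Finset.sum_ite_eq', Finset.mem_range, hk, if_true,
    (by omega : k - 1 < n + 1)]
  split_ifs with h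
  · ring
  · obtain rfl : k = n := by omega
    rw [pUp_self]
    ring

variable {n} in
/-- The magnetization chain has a strictly increasing eigenvector, with eigenvalue not `1`. -/
lemma exists_strictMono_eigenvector_magP (hn : 1 ≤ n) :
    ∃ (μ : ℝ) (f : ℕ → ℝ), μ ≠ 1 ∧ (∀ k < n, f k < f (k + 1)) ∧
      (magP n J H).mulVec (fun i => f i) = μ • fun i : Fin (n + 1) => f i := by
  set w : ℕ → ℝ := fun k => if k + 1 < n then pUp n J H (k + 1) else 1
  set d : ℕ → ℝ := fun k => 1 - pUp n J H k - pDown n J H (k + 1)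
  have hw : ∀ k, 0 < w k := fun k => by
    simp only [w]
    split_ifs with h
    exacts [pUp_pos J H h, one_pos]
  obtain ⟨μ, hpos, hzero⟩ := exists_tridiagSol_pos_eq_zero (d := d) (pDown_zero n J H)
    (fun k => pDown_pos J H hn) hw hn
  set g := tridiagSol (pDown n J H) d w μ
  set A : ℕ → ℝ := fun k => pUp n J H k * g k - pDown n J H k * g (k - 1) with hA
  have hstep : ∀ k < n, A (k + 1) - A k = (μ - 1) * g k := fun k hk => by
    have hrec : μ * g k = d k * g k + pDown n J H k * g (k - 1) + w k * g (k + 1) :=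
      tridiagSol_recurrence (pDown_zero n J H) hw μ k
    have hup : w k * g (k + 1) = pUp n J H (k + 1) * g (k + 1) := by
      simp only [w]
      split_ifs with h
      · rfl
      · rw [(by omega : k + 1 = n), hzero]
        ring
    simp only [hA, Nat.add_sub_cancel]
    rw [hup] at hrec
    simp only [d] at hrec
    linarith
  have hsum : ∀ k ≤ n, A k = A 0 + (μ - 1) * ∑ j ∈ Finset.range k, g j := fun k => by
    induction k with
    | zero => simp
    | succ k ih =>
      intro hk
      rw [Finset.sum_range_succ, mul_add, ← hstep k (by omega), ← add_assoc, ← ih (by omega)]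
      ring
  have hA0 : 0 < A 0 := by
    simp only [hA, pDown_zero, zero_mul, sub_zero]
    exact mul_pos (pUp_pos J H hn) (hpos 0 hn)
  have hAn : A n < 0 := by
    simp only [hA, pUp_self, zero_mul, zero_sub, neg_neg_iff_pos]
    exact mul_pos (pDown_pos J H hn hn) (hpos _ (by omega))
  have hμ : μ ≠ 1 := by
    rintro rfl
    have := hsum n le_rfl
    rw [sub_self, zero_mul] at this
    linarith
  refine ⟨μ, fun k => A 0 / (μ - 1) + ∑ j ∈ Finset.range k, g j, hμ, fun k hk => ?_, ?_⟩
  · simpa [Finset.sum_range_succ] using hpos k hk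
  · funext k
    obtain ⟨k, hk⟩ := k
    rw [magP_mulVec_apply n J H (fun k => A 0 / (μ - 1) + ∑ j ∈ Finset.range k, g j)]
    have hμ' : μ - 1 ≠ 0 := sub_ne_zero.2 hμ
    have hk' := hsum k (by omega)
    have hdown : pDown n J H k * (∑ j ∈ Finset.range (k - 1), g j - ∑ j ∈ Finset.range k, g j)
        = -(pDown n J H k * g (k - 1)) := by
      rcases k with _ | k
      · simp [pDown_zero]
      · simp [Finset.sum_range_succ]
    have hcancel : (μ - 1) * (A 0 / (μ - 1)) = A 0 := by field_simp
    simp only [Pi.smul_apply, smul_eq_mul, add_sub_add_left_eq_sub, hdown,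
      Finset.sum_range_succ, add_sub_cancel_left]
    simp only [hA] at hk' hcancel ⊢
    linarith

end Magnetization

/-! ### The Glauber chain -/

section Glauber

variable {n : ℕ} (J H : ℝ)

lemma glauberP_mulVec_apply (v : (Fin n → Bool) → ℝ) (σ : Fin n → Bool) :
    (glauberP n J H).mulVec v σ =
      v σ + ∑ x, flipRate n J H σ x * (v (Function.update σ x (!σ x)) - v σ) := by
  have hne : ∀ x, Function.update σ x (!σ x) ≠ σ := fun x h => by
    have := congrFun h x
    simp at this
  have hterm : ∀ τ, glauberP n J H σ τ * v τ =
      (if τ = σ then (1 - ∑ x, flipRate n J H σ x) * v τ else 0)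
        + ∑ x, if τ = Function.update σ x (!σ x) then flipRate n J H σ x * v τ else 0 := by
    intro τ
    by_cases h : τ = σ
    · subst h
      simp [glauberP, fun x => (hne x).symm]
    · simp [glauberP, h, Finset.sum_mul, ite_mul]
  simp only [Matrix.mulVec, dotProduct, hterm, Finset.sum_add_distrib]
  rw [Finset.sum_comm]
  simp only [Finset.sum_ite_eq', Finset.mem_univ, if_true, mul_sub, Finset.sum_sub_distrib,
    ← Finset.sum_mul]
  ring

/-- The probability that an update at `x` produces a plus spin. -/
noncomputable def plusProb (J H : ℝ) (σ : Fin n → Bool) (x : Fin n) : ℝ :=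
  (1 + Real.exp (-2 * (J * ∑ y ∈ Finset.univ.erase x, spin (σ y) + H)))⁻¹

lemma one_sub_inv_one_add_exp (t : ℝ) : (1 + Real.exp t)⁻¹ = 1 - (1 + Real.exp (-t))⁻¹ := by
  rw [Real.exp_neg]
  have := Real.exp_pos t
  field_simp
  ring

lemma glauberP_mulVec_eq_heatBath (hn : 1 ≤ n) (v : (Fin n → Bool) → ℝ) (σ : Fin n → Bool) :
    (glauberP n J H).mulVec v σ = ∑ x, 1 / (n : ℝ) *
      (plusProb J H σ x * v (Function.update σ x true)
        + (1 - plusProb J H σ x) * v (Function.update σ x false)) := by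
  have hn' : (n : ℝ) ≠ 0 := by exact_mod_cast (by omega : n ≠ 0)
  have hconst : v σ = ∑ _x : Fin n, 1 / (n : ℝ) * v σ := by
    simp only [Finset.sum_const, Finset.card_univ, Fintype.card_fin, nsmul_eq_mul]
    field_simp
  rw [glauberP_mulVec_apply]
  nth_rewrite 1 [hconst]
  rw [← Finset.sum_add_distrib]
  refine Finset.sum_congr rfl fun x _ => ?_
  have hself : Function.update σ x (σ x) = σ := Function.update_eq_self x σ
  unfold flipRate plusProb
  cases hx : σ x <;> rw [hx] at hself <;> rw [hself]
  · simp only [Bool.not_false, spin, if_true, mul_one]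
    ring
  · have := one_sub_inv_one_add_exp (2 * (J * ∑ y ∈ Finset.univ.erase x, spin (σ y) + H))
    simp only [Bool.not_true, spin, Bool.false_eq_true, if_false, mul_neg, mul_one, neg_neg,
      neg_mul] at this ⊢
    rw [this]
    ring

lemma spin_monotone : Monotone spin := by
  intro a b h
  cases a <;> cases b <;> first | exact absurd h (by decide) | norm_num [spin]

lemma plusProb_monotone (hJ : 0 ≤ J) (x : Fin n) :
    Monotone fun σ : Fin n → Bool => plusProb J H σ x := by
  intro σ τ h
  have hsum : ∑ y ∈ Finset.univ.erase x, spin (σ y) ≤ ∑ y ∈ Finset.univ.erase x, spin (τ y) :=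
    Finset.sum_le_sum fun y _ => spin_monotone (h y)
  have := mul_le_mul_of_nonneg_left hsum hJ
  simp only [plusProb]
  gcongr ?_⁻¹
  gcongr 1 + Real.exp ?_
  linarith

lemma plusProb_mem_Icc (σ : Fin n → Bool) (x : Fin n) : plusProb J H σ x ∈ Set.Icc 0 1 := by
  unfold plusProb
  constructor
  · positivity
  · exact inv_le_one_of_one_le₀ (le_add_of_nonneg_right (Real.exp_pos _).le)

/-- The Glauber dynamics of a ferromagnet is attractive. -/
lemma glauberP_mulVec_monotone (hn : 1 ≤ n) (hJ : 0 ≤ J) {v : (Fin n → Bool) → ℝ}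
    (hv : Monotone v) : Monotone ((glauberP n J H).mulVec v) := by
  intro σ τ h
  rw [glauberP_mulVec_eq_heatBath J H hn, glauberP_mulVec_eq_heatBath J H hn]
  refine Finset.sum_le_sum fun x _ => mul_le_mul_of_nonneg_left ?_ (by positivity)
  have hq := plusProb_monotone J H hJ x h
  obtain ⟨h₀, -⟩ := plusProb_mem_Icc J H σ x
  obtain ⟨-, h₁⟩ := plusProb_mem_Icc J H τ x
  simp only at hq
  have hup : ∀ b, v (Function.update σ x b) ≤ v (Function.update τ x b) := fun b =>
    hv (update_le_update_iff.2 ⟨le_rfl, fun y _ => h y⟩)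
  have hflip : v (Function.update τ x false) ≤ v (Function.update τ x true) :=
    hv (update_le_update_iff.2 ⟨Bool.false_le _, fun y _ => le_rfl⟩)
  nlinarith [mul_le_mul_of_nonneg_left (hup true) h₀,
    mul_le_mul_of_nonneg_left (hup false) (by linarith : 0 ≤ 1 - plusProb J H σ x),
    mul_le_mul_of_nonneg_right hq (sub_nonneg.2 hflip)]

/-- An eigenvalue with a strictly increasing eigenvector dominates all eigenvalues other than `1`:
the dynamics contracts the Lipschitz seminorm relative to that eigenvector. -/
lemma le_of_strictMono_eigenvector (hn : 1 ≤ n) (hJ : 0 ≤ J) {F : (Fin n → Bool) → ℝ} {μ : ℝ}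
    (hF : StrictMono F) (hFμ : (glauberP n J H).mulVec F = μ • F) {lam : ℝ}
    (hlam : IsEigenvalue (glauberP n J H) lam) (hne : lam ≠ 1) : lam ≤ μ := by
  obtain ⟨v, hv0, hv⟩ := hlam
  classical
  set E : Finset ((Fin n → Bool) × (Fin n → Bool)) := Finset.univ.filter fun p => p.1 < p.2
  have hE : E.Nonempty := by
    refine ⟨(fun _ => false, fun _ => true), ?_⟩
    simp only [E, Finset.mem_filter, Finset.mem_univ, true_and, Pi.lt_def]
    exact ⟨fun _ => Bool.false_le _, ⟨0, hn⟩, by simp⟩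
  obtain ⟨p, hp, hmax⟩ := E.exists_max_image (fun p => |v p.2 - v p.1| / (F p.2 - F p.1)) hE
  set L := |v p.2 - v p.1| / (F p.2 - F p.1) with hL
  have hplt : p.1 < p.2 := (Finset.mem_filter.1 hp).2
  have hpF : 0 < F p.2 - F p.1 := sub_pos.2 (hF hplt)
  have hLip : ∀ σ τ, σ ≤ τ → |v τ - v σ| ≤ L * (F τ - F σ) := by
    intro σ τ h
    rcases h.eq_or_lt with rfl | h
    · simp
    · exact (div_le_iff₀ (sub_pos.2 (hF h))).1 (hmax (σ, τ) (by simp [E, h]))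
  have hpos : 0 < |v p.2 - v p.1| := by
    by_contra hcon
    have h0 : L = 0 := by
      rw [hL, le_antisymm (not_lt.1 hcon) (abs_nonneg _), zero_div]
    have hconst : ∀ σ, v σ = v ⊥ := fun σ => by
      have := hLip ⊥ σ bot_le
      rw [h0, zero_mul] at this
      exact sub_eq_zero.1 (abs_eq_zero.1 (le_antisymm this (abs_nonneg _)))
    obtain ⟨σ, hσ⟩ := Function.ne_iff.1 hv0
    have hPσ := congrFun hv σ
    rw [glauberP_mulVec_apply] at hPσ
    simp only [hconst (Function.update _ _ _), hconst σ, sub_self, mul_zero,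
      Finset.sum_const_zero, add_zero, Pi.smul_apply, smul_eq_mul] at hPσ
    rw [hconst σ, Pi.zero_apply] at hσ
    exact hne (mul_right_cancel₀ hσ (by linarith))
  have hsub : ∀ ε : ℝ, |ε| = 1 → ε * lam * (v p.2 - v p.1) ≤ L * μ * (F p.2 - F p.1) := by
    intro ε hε
    have hmono : Monotone (L • F - ε • v) := fun σ τ h => by
      have h₁ := hLip σ τ h
      have h₂ : ε * (v τ - v σ) ≤ |v τ - v σ| := by
        simpa [abs_mul, hε] using le_abs_self (ε * (v τ - v σ))
      simp only [Pi.sub_apply, Pi.smul_apply, smul_eq_mul]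
      linarith
    have := glauberP_mulVec_monotone J H hn hJ hmono hplt.le
    rw [Matrix.mulVec_sub, Matrix.mulVec_smul, Matrix.mulVec_smul, hFμ, hv] at this
    simp only [Pi.sub_apply, Pi.smul_apply, smul_eq_mul] at this
    linarith
  have hLp : L * μ * (F p.2 - F p.1) = μ * |v p.2 - v p.1| := by
    rw [hL]
    field_simp
  refine le_of_mul_le_mul_right ?_ hpos
  rw [← hLp]
  rcases abs_choice (v p.2 - v p.1) with h | h
  · have := hsub 1 (by simp)
    rw [h]
    linarith
  · have := hsub (-1) (by simp)
    rw [h]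
    linarith

/-- The number of plus spins. -/
def plusCount (σ : Fin n → Bool) : ℕ := (Finset.univ.filter fun x => σ x = true).card

lemma plusCount_le (σ : Fin n → Bool) : plusCount σ ≤ n :=
  (Finset.card_le_univ _).trans_eq (Fintype.card_fin n)

lemma plusCount_strictMono : StrictMono (plusCount (n := n)) := by
  intro σ τ h
  obtain ⟨hle, x, hx⟩ := Pi.lt_def.1 h
  have hx' := Bool.lt_iff.1 hx
  refine Finset.card_lt_card (Finset.ssubset_iff_of_subset ?_ |>.2 ⟨x, by simp [hx'], by simp [hx']⟩)
  intro y
  simpa using fun hy => hle y hy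

lemma plusCount_update_false {σ : Fin n → Bool} {x : Fin n} (hx : σ x = true) :
    plusCount (Function.update σ x false) = plusCount σ - 1 := by
  unfold plusCount
  rw [← Finset.card_erase_of_mem (a := x) (by simp [hx])]
  congr 1
  ext y
  by_cases h : y = x <;> simp [h]

lemma plusCount_update_true {σ : Fin n → Bool} {x : Fin n} (hx : σ x = false) :
    plusCount (Function.update σ x true) = plusCount σ + 1 := by
  unfold plusCount
  rw [← Finset.card_insert_of_notMem (a := x) (by simp [hx])]
  congr 1
  ext y
  by_cases h : y = x <;> simp [h]

lemma exists_plusCount_eq {k : ℕ} (hk : k ≤ n) : ∃ σ : Fin n → Bool, plusCount σ = k := by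
  obtain ⟨s, -, hs⟩ := Finset.exists_subset_card_eq (s := (Finset.univ : Finset (Fin n))) (n := k)
    (by simpa using hk)
  exact ⟨fun x => decide (x ∈ s), by simp [plusCount, hs]⟩

lemma card_filter_eq_false (σ : Fin n → Bool) :
    ((Finset.univ.filter fun x => ¬ σ x = true).card : ℝ) = n - plusCount σ := by
  have := Finset.card_filter_add_card_filter_not (s := Finset.univ) fun x => σ x = true
  rw [Finset.card_univ, Fintype.card_fin] at this
  rw [eq_sub_iff_add_eq, add_comm]
  exact_mod_cast this

lemma sum_spin (σ : Fin n → Bool) : ∑ x, spin (σ x) = 2 * plusCount σ - n := by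
  simp only [spin, Finset.sum_ite, Finset.sum_const, nsmul_eq_mul, card_filter_eq_false]
  simp only [plusCount]
  ring

/-- The magnetization chain is a lumping of the Glauber chain. -/
lemma glauberP_mulVec_plusCount (f : ℕ → ℝ) (σ : Fin n → Bool) :
    (glauberP n J H).mulVec (fun τ => f (plusCount τ)) σ =
      (magP n J H).mulVec (fun i => f i) ⟨plusCount σ, Nat.lt_succ_of_le (plusCount_le σ)⟩ := by
  rw [magP_mulVec_apply, glauberP_mulVec_apply]
  simp only
  set k := plusCount σ with hk
  have hterm : ∀ x, flipRate n J H σ x * (f (plusCount (Function.update σ x (!σ x))) - f k) =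
      if σ x = true then 1 / (n : ℝ) *
        (1 + Real.exp (-((n : ℝ) - 2 * k + 1) * (2 * J) + 2 * H))⁻¹ * (f (k - 1) - f k)
      else 1 / (n : ℝ) *
        (1 + Real.exp (((n : ℝ) - 2 * k - 1) * (2 * J) - 2 * H))⁻¹ * (f (k + 1) - f k) := by
    intro x
    have hsum : ∑ y ∈ Finset.univ.erase x, spin (σ y) = 2 * k - n - spin (σ x) := by
      rw [← sum_spin, ← Finset.sum_erase_add _ _ (Finset.mem_univ x)]
      ring
    unfold flipRate
    rw [hsum]
    cases hx : σ x
    · simp only [Bool.not_false, plusCount_update_true hx, spin, ← hk, if_true,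
        Bool.false_eq_true, if_false]
      ring_nf
    · simp only [Bool.not_true, plusCount_update_false hx, spin, ← hk, if_true,
        Bool.false_eq_true, if_false]
      ring_nf
  simp only [hterm, Finset.sum_ite, Finset.sum_const, nsmul_eq_mul, card_filter_eq_false]
  change _ + ((k : ℝ) * _ + _) = _
  simp only [pUp, pDown, ← hk]
  ring

lemma isEigenvalue_glauberP_of_magP {μ : ℝ} (h : IsEigenvalue (magP n J H) μ) :
    IsEigenvalue (glauberP n J H) μ := by
  obtain ⟨f, hf0, hf⟩ := h
  set f' : ℕ → ℝ := fun k => f (Fin.ofNat (n + 1) k)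
  have hf' : (fun i : Fin (n + 1) => f' i) = f := by
    funext i
    simp [f']
  refine ⟨fun τ => f' (plusCount τ), ?_, ?_⟩
  · obtain ⟨i, hi⟩ := Function.ne_iff.1 hf0
    obtain ⟨σ, hσ⟩ := exists_plusCount_eq (n := n) (Nat.le_of_lt_succ i.2)
    refine Function.ne_iff.2 ⟨σ, ?_⟩
    simpa only [hσ, congrFun hf' i, Pi.zero_apply] using hi
  · funext σ
    rw [glauberP_mulVec_plusCount, hf', hf, ← hf']
    rfl

end Glauber

/-- The magnetization chain `P̃` has the same second-largest eigenvalue `λ₂` as the full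
Glauber chain `P`, and `P̃` has an increasing right eigenvector for `λ₂` which increases
strictly at some index. -/
theorem magP_secondEigenvalue_and_increasing_eigenvector
    (n : ℕ) (hn : 2 ≤ n) (J H : ℝ) (hJ : 0 < J) (lam : ℝ)
    (hlam : IsSecondEigenvalue (glauberP n J H) lam) :
    IsSecondEigenvalue (magP n J H) lam ∧
    ∃ f : Fin (n + 1) → ℝ,
      (magP n J H).mulVec f = lam • f ∧ f ≠ 0 ∧
      (∀ k : Fin n, f k.castSucc ≤ f k.succ) ∧
      (∃ k : Fin n, f k.castSucc < f k.succ) := by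
  obtain ⟨μ, f, hμ, hmono, hf⟩ := exists_strictMono_eigenvector_magP J H (by omega : 1 ≤ n)
  have hf0 : (fun i : Fin (n + 1) => f i) ≠ 0 := fun h => by
    have h0 : f 0 = 0 := congrFun h ⟨0, by omega⟩
    have h1 : f 1 = 0 := congrFun h ⟨1, by omega⟩
    have h01 : f 0 < f 1 := hmono 0 (by omega)
    linarith
  have hmag : IsEigenvalue (magP n J H) μ := ⟨_, hf0, hf⟩
  have hF : StrictMono fun σ : Fin n → Bool => f (plusCount σ) := fun σ τ h =>
    strictMonoOn_of_lt_add_one Set.ordConnected_Iic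
      (fun k _ _ hk => hmono k (Nat.lt_of_succ_le hk)) (plusCount_le σ) (plusCount_le τ)
      (plusCount_strictMono h)
  have hFμ : (glauberP n J H).mulVec (fun σ => f (plusCount σ)) =
      μ • fun σ => f (plusCount σ) := by
    funext σ
    rw [glauberP_mulVec_plusCount, hf]
    rfl
  obtain ⟨hev, hne, hmax⟩ := hlam
  obtain rfl : lam = μ := le_antisymm
    (le_of_strictMono_eigenvector J H (by omega) hJ.le hF hFμ hev hne)
    (hmax μ (isEigenvalue_glauberP_of_magP J H hmag) hμ)
  refine ⟨⟨hmag, hne, fun μ' h => hmax μ' (isEigenvalue_glauberP_of_magP J H h)⟩,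
    fun i => f i, hf, hf0, fun k => (hmono k k.2).le, ⟨0, by omega⟩, hmono 0 (by omega)⟩
end

section
/- Let n ≥ 2, J > 0 and H ∈ ℝ, and let s_k = (k(n−2k+1)/n) · 1/(1 + cosh((n−2k+1)·2J − 2H)) for 0 ≤ k ≤ n. Let Q be the (n+1)×(n+1) tridiagonal matrix with Q_{k,k−1} = s_k (1 ≤ k ≤ n), Q_{k,k+1} = s_{n−k} (0 ≤ k ≤ n−1), Q_{k,k} = −s_k − s_{n−k} (with Q_{0,−1} = Q_{n,n+1} = 0), and all other entries zero. Let f = (f_0,…,f_n) ∈ ℝ^{n+1} be increasing (f_k ≤ f_{k+1} for all k) and satisfy f_k = −f_{n−k} for all k. Then f_k · (Qf)_k ≥ 0 for every 0 ≤ k ≤ n, and consequently Σ_{k=0}^{n} π_k f_k (Qf)_k ≥ 0 for any nonnegative weights π_0, …, π_n. -/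
/-- The quantity `s_k = (k(n−2k+1)/n) · 1/(1 + cosh((n−2k+1)·2J − 2H))`. -/
noncomputable def sAux (n : ℕ) (J H : ℝ) (k : ℕ) : ℝ :=
  ((k : ℝ) * ((n : ℝ) - 2 * k + 1) / n) *
    (1 + Real.cosh (((n : ℝ) - 2 * k + 1) * (2 * J) - 2 * H))⁻¹

/-- The `(n+1)×(n+1)` tridiagonal matrix `Q` with `Q_{k,k−1} = s_k`,
`Q_{k,k+1} = s_{n−k}`, `Q_{k,k} = −s_k − s_{n−k}` and all other entries `0`.
(Note `sAux n J H 0 = 0`, matching the conventions `Q_{0,−1} = Q_{n,n+1} = 0`.) -/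
noncomputable def qMat (n : ℕ) (J H : ℝ) : Matrix (Fin (n + 1)) (Fin (n + 1)) ℝ :=
  fun k l =>
    if (l : ℕ) = (k : ℕ) + 1 then sAux n J H (n - k)
    else if (k : ℕ) = (l : ℕ) + 1 then sAux n J H k
    else if k = l then -sAux n J H k - sAux n J H (n - k)
    else 0

theorem sAux_zero (n : ℕ) (J H : ℝ) : sAux n J H 0 = 0 := by
  simp [sAux]

theorem sAux_nonneg {n k : ℕ} (J H : ℝ) (h : 2 * k ≤ n + 1) : 0 ≤ sAux n J H k := by
  have h' : (2 * k : ℝ) ≤ n + 1 := by exact_mod_cast h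
  have hc := Real.cosh_pos (((n : ℝ) - 2 * k + 1) * (2 * J) - 2 * H)
  have hd : 0 ≤ (n : ℝ) - 2 * k + 1 := by linarith
  unfold sAux
  positivity

theorem sAux_nonpos {n k : ℕ} (J H : ℝ) (h : n + 1 ≤ 2 * k) : sAux n J H k ≤ 0 := by
  have h' : (n + 1 : ℝ) ≤ 2 * k := by exact_mod_cast h
  have hc := Real.cosh_pos (((n : ℝ) - 2 * k + 1) * (2 * J) - 2 * H)
  refine mul_nonpos_of_nonpos_of_nonneg ?_ (by positivity)
  refine div_nonpos_of_nonpos_of_nonneg ?_ (Nat.cast_nonneg n)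
  exact mul_nonpos_of_nonneg_of_nonpos (Nat.cast_nonneg k) (by linarith)

/-- The rows of `qMat` sum to zero. -/
theorem sum_qMat_row (n : ℕ) (J H : ℝ) (k : Fin (n + 1)) : ∑ l, qMat n J H k l = 0 := by
  have hsplit (l : Fin (n + 1)) : qMat n J H k l =
      (if (l : ℕ) = k + 1 then sAux n J H (n - k) else 0) +
      (if (k : ℕ) = l + 1 then sAux n J H k else 0) +
      (if k = l then -sAux n J H k - sAux n J H (n - k) else 0) := by
    unfold qMat
    split_ifs <;> first | omega | simp
  have hup : ∑ l : Fin (n + 1), (if (l : ℕ) = k + 1 then sAux n J H (n - k) else 0) =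
      sAux n J H (n - k) := by
    rw [Fin.sum_univ_eq_sum_range (fun l => if l = (k : ℕ) + 1 then sAux n J H (n - k) else 0),
      Finset.sum_ite_eq']
    split_ifs with h
    · rfl
    · rw [Finset.mem_range] at h
      rw [show n - (k : ℕ) = 0 by omega, sAux_zero]
  have hdown : ∑ l : Fin (n + 1), (if (k : ℕ) = l + 1 then sAux n J H k else 0) =
      sAux n J H k := by
    rw [Fin.sum_univ_eq_sum_range (fun l => if (k : ℕ) = l + 1 then sAux n J H k else 0)]
    have hk := k.isLt
    generalize (k : ℕ) = m at hk ⊢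
    cases m with
    | zero => simp [sAux_zero]
    | succ m =>
      simp only [Nat.add_right_cancel_iff, Finset.sum_ite_eq, Finset.mem_range]
      exact if_pos (by omega)
  simp only [hsplit, Finset.sum_add_distrib, hup, hdown, Finset.sum_ite_eq, Finset.mem_univ,
    if_true]
  ring

theorem qMat_mulVec_eq_sum_sub (n : ℕ) (J H : ℝ) (f : Fin (n + 1) → ℝ) (k : Fin (n + 1)) :
    (qMat n J H).mulVec f k = ∑ l, qMat n J H k l * (f l - f k) := by
  simp only [mul_sub, Finset.sum_sub_distrib, ← Finset.sum_mul, sum_qMat_row, zero_mul, sub_zero]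
  rfl

/-- Below the midpoint, `qMat` maps a monotone vector to nonpositive entries. -/
theorem qMat_mulVec_nonpos {n : ℕ} (J H : ℝ) {f : Fin (n + 1) → ℝ} (hf : Monotone f)
    {k : Fin (n + 1)} (hk : 2 * (k : ℕ) + 1 ≤ n) : (qMat n J H).mulVec f k ≤ 0 := by
  rw [qMat_mulVec_eq_sum_sub]
  refine Finset.sum_nonpos fun l _ => ?_
  unfold qMat
  split_ifs with h₁ h₂ h₃
  · exact mul_nonpos_of_nonpos_of_nonneg (sAux_nonpos J H (by omega))
      (sub_nonneg.2 (hf (Fin.le_def.2 (by omega))))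
  · exact mul_nonpos_of_nonneg_of_nonpos (sAux_nonneg J H (by omega))
      (sub_nonpos.2 (hf (Fin.le_def.2 (by omega))))
  · simp [h₃]
  · simp

/-- Above the midpoint, `qMat` maps a monotone vector to nonnegative entries. -/
theorem qMat_mulVec_nonneg {n : ℕ} (J H : ℝ) {f : Fin (n + 1) → ℝ} (hf : Monotone f)
    {k : Fin (n + 1)} (hk : n + 1 ≤ 2 * (k : ℕ)) : 0 ≤ (qMat n J H).mulVec f k := by
  rw [qMat_mulVec_eq_sum_sub]
  refine Finset.sum_nonneg fun l _ => ?_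
  unfold qMat
  split_ifs with h₁ h₂ h₃
  · exact mul_nonneg (sAux_nonneg J H (by omega))
      (sub_nonneg.2 (hf (Fin.le_def.2 (by omega))))
  · exact mul_nonneg_of_nonpos_of_nonpos (sAux_nonpos J H (by omega))
      (sub_nonpos.2 (hf (Fin.le_def.2 (by omega))))
  · simp [h₃]
  · simp

/-- If `f` is increasing and antisymmetric (`f_k = −f_{n−k}`), then
`f_k (Qf)_k ≥ 0` for every `k`, and hence `Σ_k π_k f_k (Qf)_k ≥ 0` for any
nonnegative weights `π`.  (For `k : Fin (n+1)`, `k.rev` is the index `n − k`.) -/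
theorem qMat_quadratic_form_nonneg
    (n : ℕ) (hn : 2 ≤ n) (J H : ℝ) (hJ : 0 < J)
    (f : Fin (n + 1) → ℝ)
    (hinc : ∀ k : Fin n, f k.castSucc ≤ f k.succ)
    (hanti : ∀ k : Fin (n + 1), f k = -f k.rev) :
    (∀ k : Fin (n + 1), 0 ≤ f k * (qMat n J H).mulVec f k) ∧
    ∀ p : Fin (n + 1) → ℝ, (∀ k, 0 ≤ p k) →
      0 ≤ ∑ k : Fin (n + 1), p k * (f k * (qMat n J H).mulVec f k) := by
  have hf : Monotone f := Fin.monotone_iff_le_succ.2 hinc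
  have hpt (k : Fin (n + 1)) : 0 ≤ f k * (qMat n J H).mulVec f k := by
    have hk := hanti k
    have hrev := Fin.val_rev k
    rcases lt_trichotomy (2 * (k : ℕ)) n with h | h | h
    · have hle : f k ≤ f k.rev := hf (Fin.le_def.2 (by omega))
      exact mul_nonneg_of_nonpos_of_nonpos (by linarith) (qMat_mulVec_nonpos J H hf h)
    · rw [show k.rev = k from Fin.ext (by omega)] at hk
      rw [show f k = 0 by linarith, zero_mul]
    · have hle : f k.rev ≤ f k := hf (Fin.le_def.2 (by omega))
      exact mul_nonneg (by linarith) (qMat_mulVec_nonneg J H hf h)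
  exact ⟨hpt, fun p hp => Finset.sum_nonneg fun k _ => mul_nonneg (hp k) (hpt k)⟩
end
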